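/- arXiv:2308.10387 — 2 statements merged into one kernel-verified Lean document; each statement's English description precedes it below -/
import Mathlib

section
/- If a ∈ R[t_1,…,t_n] ⊆ H_{n,r} is invariant under the simple transposition s_p (i.e., writing a = Σ_{(k_1,…,k_n)} a_{(k_1,…,k_n)} b_{k_1,…,k_n}, one has a_{(k_1,…,k_p,k_{p+1},…,k_n)} = a_{(k_1,…,k_{p+1},k_p,…,k_n)} for all (k_1,…,k_n) ∈ [1,r]^n), then T_p·a = a·T_p in H_{n,r}. -/
open Polynomial

namespace MAK

noncomputable section

variable (R : Type*) [CommRing R] (n r : ℕ) (q Δ : Rˣ) (u : Fin r → R) (F : Fin r → R[X])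

/-- The free `R`-algebra on generators `t_1, …, t_n` (left) and `T_1, …, T_{n-1}` (right). -/
abbrev FA := FreeAlgebra R (Fin n ⊕ Fin (n - 1))

/-- The generators `t_i`. -/
def tf (i : Fin n) : FA R n := FreeAlgebra.ι R (Sum.inl i)

/-- The generators `T_j`. -/
def Tf (j : Fin (n - 1)) : FA R n := FreeAlgebra.ι R (Sum.inr j)

/-- The index `j`, viewed in `Fin n`. -/
def lo (j : Fin (n - 1)) : Fin n := ⟨j.1, by have := j.2; omega⟩

/-- The index `j + 1`, viewed in `Fin n`. -/
def hi (j : Fin (n - 1)) : Fin n := ⟨j.1 + 1, by have := j.2; omega⟩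

/-- The element `B_j = Δ⁻² Σ_{c1<c2} (u_{c2} - u_{c1})(q - q⁻¹) F_{c1}(t_j) F_{c2}(t_{j+1})`. -/
def Bel (j : Fin (n - 1)) : FA R n :=
  ∑ c2 : Fin r, ∑ c1 ∈ Finset.univ.filter (fun c1 => c1 < c2),
    (((Δ⁻¹ : Rˣ) : R) ^ 2 * ((u c2 - u c1) * ((q : R) - ((q⁻¹ : Rˣ) : R)))) •
      (aeval (tf R n (lo n j)) (F c1) * aeval (tf R n (hi n j)) (F c2))

/-- The defining relations of the modified Ariki-Koike algebra. -/
inductive Rel : FA R n → FA R n → Prop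
  | quad (j : Fin (n - 1)) :
      Rel ((Tf R n j - algebraMap R (FA R n) (q : R)) *
        (Tf R n j + algebraMap R (FA R n) ((q⁻¹ : Rˣ) : R))) 0
  | tord (i : Fin n) : Rel (aeval (tf R n i) (∏ c : Fin r, (X - C (u c)))) 0
  | braid (j k : Fin (n - 1)) (h : k.1 = j.1 + 1) :
      Rel (Tf R n j * Tf R n k * Tf R n j) (Tf R n k * Tf R n j * Tf R n k)
  | Tcomm (j k : Fin (n - 1)) (h : j.1 + 2 ≤ k.1 ∨ k.1 + 2 ≤ j.1) :
      Rel (Tf R n j * Tf R n k) (Tf R n k * Tf R n j)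
  | tcomm (i i' : Fin n) : Rel (tf R n i * tf R n i') (tf R n i' * tf R n i)
  | Tt (j : Fin (n - 1)) (i : Fin n) (h1 : i ≠ lo n j) (h2 : i ≠ hi n j) :
      Rel (Tf R n j * tf R n i) (tf R n i * Tf R n j)
  | Thi (j : Fin (n - 1)) :
      Rel (Tf R n j * tf R n (hi n j)) (tf R n (lo n j) * Tf R n j + Bel R n r q Δ u F j)
  | Tlo (j : Fin (n - 1)) :
      Rel (Tf R n j * tf R n (lo n j)) (tf R n (hi n j) * Tf R n j - Bel R n r q Δ u F j)

/-- The modified Ariki-Koike algebra `H_{n,r}(R, q, u_1, …, u_r)`. -/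
abbrev Hnr := RingQuot (Rel R n r q Δ u F)

/-- The canonical projection. -/
def pim : FA R n →ₐ[R] Hnr R n r q Δ u F := RingQuot.mkAlgHom R (Rel R n r q Δ u F)

/-- The generator `t_i` of `H_{n,r}`. -/
def tt (i : Fin n) : Hnr R n r q Δ u F := pim R n r q Δ u F (tf R n i)

/-- The generator `T_j` of `H_{n,r}`. -/
def TT (j : Fin (n - 1)) : Hnr R n r q Δ u F := pim R n r q Δ u F (Tf R n j)

/-- The Lagrange basis polynomial `∏_{j ≠ c} (X - u_j)/(u_c - u_j)`. -/
def bpoly (c : Fin r) : R[X] :=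
  ∏ j ∈ Finset.univ.filter (fun j => j ≠ c), Ring.inverse (u c - u j) • (X - C (u j))

/-- The idempotent `b_{k_1, …, k_n}`. -/
def b (k : Fin n → Fin r) : Hnr R n r q Δ u F :=
  (List.ofFn fun i : Fin n => aeval (tt R n r q Δ u F i) (bpoly R r u (k i))).prod

/-- The element `B'_{i,j} = -(q - q⁻¹) Σ_{k_i < k_j} b_{k_1, …, k_n}`. -/
def B' (i j : Fin n) : Hnr R n r q Δ u F :=
  -(((q : R) - ((q⁻¹ : Rˣ) : R)) •
    ∑ k ∈ Finset.univ.filter (fun k : Fin n → Fin r => k i < k j), b R n r q Δ u F k)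

/-- The element `g_i := T_i + B'_{i,i+1}`. -/
def g (j : Fin (n - 1)) : Hnr R n r q Δ u F :=
  TT R n r q Δ u F j + B' R n r q Δ u F (lo n j) (hi n j)

/-- The idempotent `e_{i,j} = Σ_{k_i = k_j} b_{k_1, …, k_n}`. -/
def eij (i j : Fin n) : Hnr R n r q Δ u F :=
  ∑ k ∈ Finset.univ.filter (fun k : Fin n → Fin r => k i = k j), b R n r q Δ u F k

/-- The idempotent `e_i = e_{i,i+1}`. -/
def ee (j : Fin (n - 1)) : Hnr R n r q Δ u F := eij R n r q Δ u F (lo n j) (hi n j)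

/-- The simple transposition `s_j = (j, j+1)` in `S_n`. -/
def simple (j : Fin (n - 1)) : Equiv.Perm (Fin n) := Equiv.swap (lo n j) (hi n j)

/-- `l` is a reduced word for the permutation `w`. -/
def IsReducedWord (w : Equiv.Perm (Fin n)) (l : List (Fin (n - 1))) : Prop :=
  (l.map (simple n)).prod = w ∧
    ∀ l' : List (Fin (n - 1)), (l'.map (simple n)).prod = w → l.length ≤ l'.length

/-- The element `g_w = g_{i_1} ⋯ g_{i_l}` associated to a word `l = (i_1, …, i_l)`. -/
def gword (l : List (Fin (n - 1))) : Hnr R n r q Δ u F := (l.map (g R n r q Δ u F)).prod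

/-- The element `T_w = T_{i_1} ⋯ T_{i_l}` associated to a word `l = (i_1, …, i_l)`. -/
def Tword (l : List (Fin (n - 1))) : Hnr R n r q Δ u F := (l.map (TT R n r q Δ u F)).prod

/-- The monomial `t_1^{c_1} ⋯ t_n^{c_n}`. -/
def tmon (c : Fin n → ℕ) : Hnr R n r q Δ u F :=
  (List.ofFn fun i : Fin n => tt R n r q Δ u F i ^ c i).prod

end

end MAK

open MAK


namespace MAK

theorem semiconjBy_aeval {R A : Type*} [CommSemiring R] [Semiring A] [Algebra R A] {g x y : A}
    (h : SemiconjBy g x y) (P : R[X]) : SemiconjBy g (aeval x P) (aeval y P) := by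
  induction P using Polynomial.induction_on' with
  | add P Q hP hQ => simpa only [map_add] using hP.add_right hQ
  | monomial m c =>
    simp only [aeval_monomial]
    exact SemiconjBy.mul_right (Algebra.commutes c g).symm (h.pow_right m)

theorem semiconjBy_prod_ofFn {A : Type*} [Monoid A] {g : A} :
    ∀ {n : ℕ} {f f' : Fin n → A}, (∀ i, SemiconjBy g (f i) (f' i)) →
      SemiconjBy g (List.ofFn f).prod (List.ofFn f').prod
  | 0, _, _, _ => by simp
  | n + 1, f, f', h => by
    simp only [List.ofFn_succ, List.prod_cons]
    exact (h 0).mul_right (semiconjBy_prod_ofFn fun i => h i.succ)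

theorem prod_ofFn_comp_perm {A : Type*} [Monoid A] {n : ℕ} {f : Fin n → A}
    (h : ∀ i j, Commute (f i) (f j)) (σ : Equiv.Perm (Fin n)) :
    (List.ofFn (f ∘ σ)).prod = (List.ofFn f).prod :=
  (Equiv.Perm.ofFn_comp_perm σ f).prod_eq' <|
    List.pairwise_of_forall_mem_list fun x hx y hy => by
      obtain ⟨i, rfl⟩ := (List.mem_ofFn' _ _).1 hx
      obtain ⟨j, rfl⟩ := (List.mem_ofFn' _ _).1 hy
      exact h _ _

theorem isUnit_sub_of_isUnit_prod {R : Type*} [CommRing R] {r : ℕ} {u : Fin r → R}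
    (h : IsUnit (∏ i : Fin r, ∏ j ∈ Finset.univ.filter (fun j => j < i), (u i - u j)))
    {i j : Fin r} (hij : i ≠ j) : IsUnit (u i - u j) := by
  have key : ∀ i j : Fin r, j < i → IsUnit (u i - u j) := fun i j hji =>
    isUnit_of_dvd_unit
      ((Finset.dvd_prod_of_mem (fun j => u i - u j)
        (Finset.mem_filter.2 ⟨Finset.mem_univ j, hji⟩)).trans
        (Finset.dvd_prod_of_mem
          (fun i => ∏ j ∈ Finset.univ.filter (fun j => j < i), (u i - u j))
          (Finset.mem_univ i))) h
  rcases lt_or_gt_of_ne hij with h' | h'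
  · rw [← neg_sub]
    exact (key j i h').neg
  · exact key i j h'

theorem prod_X_sub_C_dvd {R : Type*} [CommRing R] {r : ℕ} {u : Fin r → R}
    (hu : ∀ i j, i ≠ j → IsUnit (u i - u j)) {P : R[X]} (hP : ∀ c, P.eval (u c) = 0) :
    (∏ c : Fin r, (X - C (u c))) ∣ P :=
  Fintype.prod_dvd_of_coprime (fun i j hij => isCoprime_X_sub_C_of_isUnit_sub (hu i j hij))
    fun c => dvd_iff_isRoot.2 (hP c)

theorem sub_mul_mul_of_mul_eq_smul {R A : Type*} [CommRing R] [Ring A] [Algebra R A]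
    {x y e f : A} {α β : R} (he : x * e = α • e) (hf : y * f = β • f) (h : Commute y e) :
    (y - x) * (e * f) = (β - α) • (e * f) := by
  rw [sub_mul, h.left_comm, hf, ← mul_assoc x, he, mul_smul_comm, smul_mul_assoc, sub_smul]

section

variable (R : Type*) [CommRing R] (n r : ℕ) (q Δ : Rˣ) (u : Fin r → R) (F : Fin r → R[X])

theorem commute_tt (i j : Fin n) :
    Commute (tt R n r q Δ u F i) (tt R n r q Δ u F j) := by
  have := RingQuot.mkAlgHom_rel R (Rel.tcomm (q := q) (Δ := Δ) (u := u) (F := F) i j)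
  rwa [map_mul, map_mul] at this

theorem commute_aeval_tt (i j : Fin n) (P Q : R[X]) :
    Commute (aeval (tt R n r q Δ u F i) P) (aeval (tt R n r q Δ u F j) Q) :=
  (semiconjBy_aeval (Commute.symm (semiconjBy_aeval (commute_tt R n r q Δ u F i j) Q)) P).symm

theorem aeval_tt_prod (i : Fin n) :
    aeval (tt R n r q Δ u F i) (∏ c : Fin r, (X - C (u c))) = 0 := by
  have := RingQuot.mkAlgHom_rel R (Rel.tord (q := q) (Δ := Δ) (u := u) (F := F) i)
  rw [map_zero] at this
  rw [← this]
  exact aeval_algHom_apply (pim R n r q Δ u F) _ _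

/-- The image of `Bel` in `H_{n,r}`, with the factors `u c2 - u c1` replaced by `v c1 c2`. -/
noncomputable def weightedBel (v : Fin r → Fin r → R) (j : Fin (n - 1)) : Hnr R n r q Δ u F :=
  ∑ c2 : Fin r, ∑ c1 ∈ Finset.univ.filter (fun c1 => c1 < c2),
    (((Δ⁻¹ : Rˣ) : R) ^ 2 * (v c1 c2 * ((q : R) - ((q⁻¹ : Rˣ) : R)))) •
      (aeval (tt R n r q Δ u F (lo n j)) (F c1) * aeval (tt R n r q Δ u F (hi n j)) (F c2))

theorem pim_Bel (j : Fin (n - 1)) :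
    pim R n r q Δ u F (Bel R n r q Δ u F j) =
      weightedBel R n r q Δ u F (fun c1 c2 => u c2 - u c1) j := by
  simp only [Bel, weightedBel, map_sum, map_smul, map_mul, tt, aeval_algHom_apply]

theorem commute_weightedBel (v : Fin r → Fin r → R) (j : Fin (n - 1)) (i : Fin n) (P : R[X]) :
    Commute (weightedBel R n r q Δ u F v j) (aeval (tt R n r q Δ u F i) P) :=
  Commute.sum_left _ _ _ fun _ _ => Commute.sum_left _ _ _ fun _ _ =>
    ((commute_aeval_tt R n r q Δ u F _ _ _ _).mul_left
      (commute_aeval_tt R n r q Δ u F _ _ _ _)).smul_left _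

theorem commute_weightedBel_tt (v : Fin r → Fin r → R) (j : Fin (n - 1)) (i : Fin n) :
    Commute (weightedBel R n r q Δ u F v j) (tt R n r q Δ u F i) := by
  simpa only [aeval_X] using commute_weightedBel R n r q Δ u F v j i X

theorem TT_mul_tt_hi (j : Fin (n - 1)) :
    TT R n r q Δ u F j * tt R n r q Δ u F (hi n j) =
      tt R n r q Δ u F (lo n j) * TT R n r q Δ u F j +
        weightedBel R n r q Δ u F (fun c1 c2 => u c2 - u c1) j := by
  have := RingQuot.mkAlgHom_rel R (Rel.Thi (q := q) (Δ := Δ) (u := u) (F := F) j)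
  rw [← pim_Bel]
  rwa [map_mul, map_add, map_mul] at this

theorem TT_mul_tt_lo (j : Fin (n - 1)) :
    TT R n r q Δ u F j * tt R n r q Δ u F (lo n j) =
      tt R n r q Δ u F (hi n j) * TT R n r q Δ u F j -
        weightedBel R n r q Δ u F (fun c1 c2 => u c2 - u c1) j := by
  have := RingQuot.mkAlgHom_rel R (Rel.Tlo (q := q) (Δ := Δ) (u := u) (F := F) j)
  rw [← pim_Bel]
  rwa [map_mul, map_sub, map_mul] at this

theorem commute_TT_tt (j : Fin (n - 1)) (i : Fin n) (h1 : i ≠ lo n j) (h2 : i ≠ hi n j) :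
    Commute (TT R n r q Δ u F j) (tt R n r q Δ u F i) := by
  have := RingQuot.mkAlgHom_rel R (Rel.Tt (r := r) (q := q) (Δ := Δ) (u := u) (F := F) j i h1 h2)
  rwa [map_mul, map_mul] at this

variable {R n r q Δ u F}

theorem tt_mul_aeval (hu : ∀ i j, i ≠ j → IsUnit (u i - u j))
    (hF : ∀ c c', c' ≠ c → (F c).eval (u c') = 0) (i : Fin n) (c : Fin r) :
    tt R n r q Δ u F i * aeval (tt R n r q Δ u F i) (F c) =
      u c • aeval (tt R n r q Δ u F i) (F c) := by
  have hdvd : (∏ c : Fin r, (X - C (u c))) ∣ (X - C (u c)) * F c :=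
    prod_X_sub_C_dvd hu fun c' => by
      by_cases h : c' = c
      · simp [h]
      · simp [hF c c' h]
  obtain ⟨Q, hQ⟩ := hdvd
  have h0 : aeval (tt R n r q Δ u F i) ((X - C (u c)) * F c) = 0 := by
    rw [hQ, map_mul, aeval_tt_prod, zero_mul]
  rw [map_mul, map_sub, aeval_X, aeval_C, sub_mul, sub_eq_zero] at h0
  rw [h0, Algebra.smul_def]

theorem weightedBel_one_mul_sub (hu : ∀ i j, i ≠ j → IsUnit (u i - u j))
    (hF : ∀ c c', c' ≠ c → (F c).eval (u c') = 0) (j : Fin (n - 1)) :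
    (tt R n r q Δ u F (hi n j) - tt R n r q Δ u F (lo n j)) *
        weightedBel R n r q Δ u F (fun _ _ => 1) j =
      weightedBel R n r q Δ u F (fun c1 c2 => u c2 - u c1) j := by
  simp only [weightedBel, Finset.mul_sum]
  refine Finset.sum_congr rfl fun c2 _ => Finset.sum_congr rfl fun c1 _ => ?_
  have hlo := tt_mul_aeval (q := q) (Δ := Δ) hu hF (lo n j) c1
  have hhi := tt_mul_aeval (q := q) (Δ := Δ) hu hF (hi n j) c2
  have hc : Commute (tt R n r q Δ u F (hi n j)) (aeval (tt R n r q Δ u F (lo n j)) (F c1)) := by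
    simpa only [aeval_X] using commute_aeval_tt R n r q Δ u F (hi n j) (lo n j) X (F c1)
  rw [mul_smul_comm, sub_mul_mul_of_mul_eq_smul hlo hhi hc, smul_smul]
  congr 1
  ring

/-- The element `T_j - Q` where `Q` is `weightedBel` with weights `1`
intertwines `t_i` with `t_{s_j(i)}`. -/
theorem semiconjBy_TT_sub_weightedBel (hu : ∀ i j, i ≠ j → IsUnit (u i - u j))
    (hF : ∀ c c', c' ≠ c → (F c).eval (u c') = 0) (j : Fin (n - 1)) (i : Fin n) :
    SemiconjBy (TT R n r q Δ u F j - weightedBel R n r q Δ u F (fun _ _ => 1) j)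
      (tt R n r q Δ u F i) (tt R n r q Δ u F (Equiv.swap (lo n j) (hi n j) i)) := by
  have hB := weightedBel_one_mul_sub (q := q) (Δ := Δ) hu hF j
  have hcomm := commute_weightedBel_tt R n r q Δ u F (fun _ _ => 1) j
  by_cases h1 : i = lo n j
  · subst h1
    rw [Equiv.swap_apply_left, SemiconjBy, sub_mul, mul_sub, TT_mul_tt_lo, ← hB, (hcomm _).eq]
    simp only [sub_mul]
    abel
  by_cases h2 : i = hi n j
  · subst h2
    rw [Equiv.swap_apply_right, SemiconjBy, sub_mul, mul_sub, TT_mul_tt_hi, ← hB, (hcomm _).eq]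
    simp only [sub_mul]
    abel
  rw [Equiv.swap_apply_of_ne_of_ne h1 h2]
  exact (commute_TT_tt R n r q Δ u F j i h1 h2).sub_left (hcomm i)

theorem semiconjBy_b {g : Hnr R n r q Δ u F} {σ : Equiv.Perm (Fin n)}
    (h : ∀ i, SemiconjBy g (tt R n r q Δ u F i) (tt R n r q Δ u F (σ i))) (k : Fin n → Fin r) :
    SemiconjBy g (b R n r q Δ u F (k ∘ σ)) (b R n r q Δ u F k) := by
  have := semiconjBy_prod_ofFn fun i => semiconjBy_aeval (h i) (bpoly R r u (k (σ i)))
  have hp := prod_ofFn_comp_perm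
    (f := fun i => aeval (tt R n r q Δ u F i) (bpoly R r u (k i)))
    (fun i j => commute_aeval_tt R n r q Δ u F i j _ _) σ
  rw [b, b, ← hp]
  exact this

theorem commute_weightedBel_b (v : Fin r → Fin r → R) (j : Fin (n - 1)) (k : Fin n → Fin r) :
    Commute (weightedBel R n r q Δ u F v j) (b R n r q Δ u F k) :=
  semiconjBy_b (σ := 1) (commute_weightedBel_tt R n r q Δ u F v j) k

theorem commute_sum_b {g : Hnr R n r q Δ u F} {σ : Equiv.Perm (Fin n)}
    (h : ∀ i, SemiconjBy g (tt R n r q Δ u F i) (tt R n r q Δ u F (σ i)))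
    {a : (Fin n → Fin r) → R} (ha : ∀ k, a (k ∘ σ) = a k) :
    Commute g (∑ k, a k • b R n r q Δ u F k) := by
  rw [Commute, SemiconjBy, Finset.mul_sum, Finset.sum_mul]
  refine (Fintype.sum_equiv (Equiv.arrowCongr σ.symm (Equiv.refl (Fin r))) _ _ fun k => ?_).symm
  change a k • b R n r q Δ u F k * g = g * (a (k ∘ σ) • b R n r q Δ u F (k ∘ σ))
  rw [ha, mul_smul_comm, (semiconjBy_b h k).eq, smul_mul_assoc]

end

end MAK

/-- Lemma 2.5: `T_p` commutes with `s_p`-invariant elements of `R[t_1,…,t_n]`. -/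
theorem statement2
    (R : Type*) [CommRing R] [IsDomain R] (n r : ℕ) (hn : 1 ≤ n) (hr : 1 ≤ r)
    (q Δ : Rˣ) (u : Fin r → R) (F : Fin r → R[X])
    (hΔ : (Δ : R) = ∏ i : Fin r, ∏ j ∈ Finset.univ.filter (fun j => j < i), (u i - u j))
    (hFdeg : ∀ c : Fin r, (F c).degree = ((r - 1 : ℕ) : WithBot ℕ))
    (hFeval : ∀ c c' : Fin r, (F c).eval (u c') = if c' = c then (Δ : R) else 0)
    (p : Fin (n - 1)) (a : (Fin n → Fin r) → R)
    (ha : ∀ k : Fin n → Fin r, a (fun i => k (Equiv.swap (lo n p) (hi n p) i)) = a k) :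
    TT R n r q Δ u F p * (∑ k : Fin n → Fin r, a k • b R n r q Δ u F k) =
      (∑ k : Fin n → Fin r, a k • b R n r q Δ u F k) * TT R n r q Δ u F p := by
  have hu : ∀ i j, i ≠ j → IsUnit (u i - u j) := fun i j hij =>
    isUnit_sub_of_isUnit_prod (hΔ ▸ Δ.isUnit) hij
  have hF : ∀ c c', c' ≠ c → (F c).eval (u c') = 0 := fun c c' h => by rw [hFeval, if_neg h]
  have hg := commute_sum_b (semiconjBy_TT_sub_weightedBel (q := q) (Δ := Δ) hu hF p) (a := a) ha
  have hB : Commute (weightedBel R n r q Δ u F (fun _ _ => 1) p)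
      (∑ k : Fin n → Fin r, a k • b R n r q Δ u F k) :=
    Commute.sum_right _ _ _ fun k _ => (commute_weightedBel_b _ p k).smul_right _
  simpa only [sub_add_cancel] using (hg.add_left hB).eq
end

section
/- For all 1 ≤ i ≤ n and 1 ≤ j ≤ n−1, one has g_j·t_i = t_{s_j(i)}·g_j in H_{n,r}, where s_j is the transposition of j and j+1. Consequently, for every polynomial f in n variables, g_j·f(t_1,…,t_n) = f(t_{s_j(1)},…,t_{s_j(n)})·g_j. -/
open Polynomial

open MAK

namespace MAK

/-- Pairwise commuting elements of an algebra can be substituted into polynomials. -/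
theorem exists_mvPolynomial_algHom {R A σ : Type*} [CommRing R] [Ring A] [Algebra R A]
    (x : σ → A) (hx : ∀ i j, x i * x j = x j * x i) :
    ∃ φ : MvPolynomial σ R →ₐ[R] A, ∀ i, φ (MvPolynomial.X i) = x i := by
  have hcomm := Algebra.isMulCommutative_adjoin R (s := Set.range x) (by
    rintro _ ⟨i, rfl⟩ _ ⟨j, rfl⟩
    exact hx i j)
  let : CommRing (Algebra.adjoin R (Set.range x)) :=
    { (Algebra.adjoin R (Set.range x)).toRing with mul_comm := hcomm.is_comm.comm }
  refine ⟨(Algebra.adjoin R (Set.range x)).val.comp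
    (MvPolynomial.aeval fun i => ⟨x i, Algebra.subset_adjoin ⟨i, rfl⟩⟩), fun i => ?_⟩
  simp

/-- Marginalising a product of partitions of unity onto two distinct coordinates. -/
theorem sum_filter_prod_eq {A ι κ : Type*} [CommRing A] [Fintype ι] [DecidableEq ι]
    [Fintype κ] [LinearOrder κ] (f : ι → κ → A) (hf : ∀ i, ∑ c, f i c = 1)
    {a b : ι} (hab : a ≠ b) :
    ∑ k ∈ Finset.univ.filter (fun k : ι → κ => k a < k b), ∏ i, f i (k i) =
      ∑ c2, ∑ c1 ∈ Finset.univ.filter (fun c1 => c1 < c2), f a c1 * f b c2 := by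
  have key : ∀ c1 c2 : κ, f a c1 * f b c2 =
      ∑ k ∈ Finset.univ.filter (fun k : ι → κ => k a = c1 ∧ k b = c2), ∏ i, f i (k i) := by
    intro c1 c2
    let s : ι → Finset κ := fun i => if i = a then {c1} else if i = b then {c2} else Finset.univ
    have hs : Finset.univ.filter (fun k : ι → κ => k a = c1 ∧ k b = c2) =
        Fintype.piFinset s := by
      ext k
      simp only [Finset.mem_filter, Finset.mem_univ, true_and, Fintype.mem_piFinset, s]
      constructor
      · rintro ⟨h1, h2⟩ i
        split_ifs with ha hb
        · simp [ha, h1]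
        · simp [hb, h2]
        · simp
      · intro h
        refine ⟨by simpa using h a, by simpa [hab.symm] using h b⟩
    rw [hs, ← Finset.prod_univ_sum, ← Finset.mul_prod_erase _ _ (Finset.mem_univ a),
      ← Finset.mul_prod_erase _ _ (Finset.mem_erase.2 ⟨hab.symm, Finset.mem_univ b⟩),
      Finset.prod_eq_one]
    · simp [s, hab.symm]
    · intro i hi
      simp only [Finset.mem_erase, Finset.mem_univ, and_true] at hi
      simp [s, hi.1, hi.2, hf]
  simp_rw [key, Finset.sum_filter]
  simp_rw [← Finset.sum_filter, Finset.sum_sigma']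
  refine Finset.sum_bij' (fun k _ => ⟨k b, k a, k⟩) (fun p _ => p.2.2) ?_ ?_ ?_ ?_ ?_
  · simp
  · rintro ⟨c2, c1, k⟩ h
    simp only [Finset.mem_sigma, Finset.mem_filter, Finset.mem_univ, true_and] at h
    obtain ⟨h, rfl, rfl⟩ := h
    simpa using h
  · simp
  · rintro ⟨c2, c1, k⟩ h
    simp only [Finset.mem_sigma, Finset.mem_filter, Finset.mem_univ, true_and] at h
    obtain ⟨h, rfl, rfl⟩ := h
    rfl
  · simp

/-- Multiplying a sum of products of eigenvectors of `x` and `y` by `x - y`. -/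
theorem neg_smul_sum_mul_sub {R A κ : Type*} [CommRing R] [Ring A] [Algebra R A] [Fintype κ]
    [LinearOrder κ] (s : R) (u : κ → R) (e f : κ → A) {x y : A} (he : ∀ c, e c * x = u c • e c)
    (hf : ∀ c, f c * y = u c • f c) (hfx : ∀ c, f c * x = x * f c) :
    -(s • ∑ c2, ∑ c1 ∈ Finset.univ.filter (fun c1 => c1 < c2), e c1 * f c2) * (x - y) =
      ∑ c2, ∑ c1 ∈ Finset.univ.filter (fun c1 => c1 < c2),
        ((u c2 - u c1) * s) • (e c1 * f c2) := by
  simp_rw [neg_mul, smul_mul_assoc, Finset.sum_mul, Finset.smul_sum, ← Finset.sum_neg_distrib]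
  refine Finset.sum_congr rfl fun c2 _ => Finset.sum_congr rfl fun c1 _ => ?_
  rw [mul_sub, mul_assoc, hfx, ← mul_assoc, he, mul_assoc, hf,
    smul_mul_assoc, mul_smul_comm, ← sub_smul, smul_smul, ← neg_smul]
  congr 1
  ring

section Lagrange

variable {R : Type*} [CommRing R] {r : ℕ} {Δ : Rˣ} {u : Fin r → R}

theorem isUnit_sub_of_ne
    (hΔ : (Δ : R) = ∏ i : Fin r, ∏ j ∈ Finset.univ.filter (fun j => j < i), (u i - u j))
    {c d : Fin r} (h : c ≠ d) : IsUnit (u c - u d) := by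
  have lt : ∀ c d : Fin r, d < c → IsUnit (u c - u d) := by
    intro c d h
    refine isUnit_of_dvd_unit ?_ Δ.isUnit
    rw [hΔ]
    exact (Finset.dvd_prod_of_mem (fun j => u c - u j) (by simpa using h)).trans
      (Finset.dvd_prod_of_mem
        (fun i => ∏ j ∈ Finset.univ.filter (fun j => j < i), (u i - u j)) (Finset.mem_univ c))
  rcases lt_or_gt_of_ne h with h | h
  · simpa using (lt d c h).neg
  · exact lt c d h

theorem injective_of_isUnit_sub [Nontrivial R] (hu : ∀ c d : Fin r, c ≠ d → IsUnit (u c - u d)) :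
    Function.Injective u := by
  intro c d h
  by_contra hne
  simpa [h] using hu c d hne

theorem bpoly_eval (hu : ∀ c d : Fin r, c ≠ d → IsUnit (u c - u d)) (c d : Fin r) :
    (bpoly R r u c).eval (u d) = if d = c then 1 else 0 := by
  rw [bpoly, eval_prod]
  split_ifs with h
  · subst h
    refine Finset.prod_eq_one fun j hj => ?_
    simp only [Finset.mem_filter, Finset.mem_univ, true_and] at hj
    simpa using Ring.inverse_mul_cancel _ (hu d j hj.symm)
  · exact Finset.prod_eq_zero (i := d) (by simpa using h) (by simp)

theorem bpoly_degree_lt (c : Fin r) : (bpoly R r u c).degree < (r : WithBot ℕ) := by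
  have h : (bpoly R r u c).natDegree ≤ r - 1 := by
    refine (natDegree_prod_le _ _).trans ((Finset.sum_le_card_nsmul _ _ 1 fun j _ => ?_).trans ?_)
    · exact (natDegree_smul_le _ _).trans (natDegree_X_sub_C_le _)
    · simp [Finset.filter_ne', Finset.card_erase_of_mem]
  refine (degree_le_of_natDegree_le h).trans_lt ?_
  have := c.pos
  exact_mod_cast (by omega : r - 1 < r)

theorem eq_of_eval_eq [IsDomain R] (hu : ∀ c d : Fin r, c ≠ d → IsUnit (u c - u d)) {f g : R[X]}
    (hf : f.degree < (r : WithBot ℕ)) (hg : g.degree < (r : WithBot ℕ))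
    (h : ∀ c, f.eval (u c) = g.eval (u c)) : f = g :=
  eq_of_degrees_lt_of_eval_index_eq Finset.univ (injective_of_isUnit_sub hu).injOn
    (by simpa using hf) (by simpa using hg) fun c _ => h c

theorem sum_bpoly [IsDomain R] (hr : 1 ≤ r)
    (hu : ∀ c d : Fin r, c ≠ d → IsUnit (u c - u d)) : ∑ c, bpoly R r u c = 1 := by
  refine eq_of_eval_eq hu ?_ ?_ fun c => ?_
  · exact (degree_sum_le _ _).trans_lt
      ((Finset.sup_lt_iff (WithBot.bot_lt_coe r)).2 fun c _ => bpoly_degree_lt c)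
  · rw [degree_one]
    exact_mod_cast hr
  · simp [eval_finsetSum, bpoly_eval hu]

theorem eq_smul_bpoly [IsDomain R] (hr : 1 ≤ r)
    (hu : ∀ c d : Fin r, c ≠ d → IsUnit (u c - u d)) {p : R[X]} {c : Fin r}
    (hdeg : p.degree = ((r - 1 : ℕ) : WithBot ℕ))
    (heval : ∀ c', p.eval (u c') = if c' = c then (Δ : R) else 0) :
    p = (Δ : R) • bpoly R r u c := by
  refine eq_of_eval_eq hu ?_ ((degree_smul_le _ _).trans_lt (bpoly_degree_lt c)) fun d => ?_
  · rw [hdeg]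
    exact_mod_cast (by omega : r - 1 < r)
  · simp [heval, bpoly_eval hu]

theorem bpoly_mul_X_sub_C (c : Fin r) :
    ∃ a : R, bpoly R r u c * (X - C (u c)) = a • ∏ d : Fin r, (X - C (u d)) := by
  refine ⟨∏ j ∈ Finset.univ.filter (fun j => j ≠ c), Ring.inverse (u c - u j), ?_⟩
  rw [bpoly, Finset.prod_smul, smul_mul_assoc, Finset.filter_ne', mul_comm,
    Finset.mul_prod_erase _ (fun d => X - C (u d)) (Finset.mem_univ c), smul_eq_C_mul]

end Lagrange

section Relations

variable {R : Type*} [CommRing R] {n r : ℕ} {q Δ : Rˣ} {u : Fin r → R} {F : Fin r → R[X]}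

theorem pim_eq {x y : FA R n} (h : Rel R n r q Δ u F x y) :
    pim R n r q Δ u F x = pim R n r q Δ u F y :=
  RingQuot.mkAlgHom_rel R h

theorem tt_comm (i j : Fin n) :
    tt R n r q Δ u F i * tt R n r q Δ u F j = tt R n r q Δ u F j * tt R n r q Δ u F i := by
  simpa [tt] using pim_eq (Rel.tcomm (q := q) (Δ := Δ) (u := u) (F := F) i j)

theorem aeval_bpoly_mul_tt (i : Fin n) (c : Fin r) :
    aeval (tt R n r q Δ u F i) (bpoly R r u c) * tt R n r q Δ u F i =
      u c • aeval (tt R n r q Δ u F i) (bpoly R r u c) := by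
  obtain ⟨a, ha⟩ := bpoly_mul_X_sub_C (u := u) c
  have h := pim_eq (Rel.tord (q := q) (Δ := Δ) (u := u) (F := F) i)
  rw [← aeval_algHom_apply, map_zero] at h
  have h2 := congrArg (aeval (tt R n r q Δ u F i)) ha
  rw [map_smul] at h2
  erw [h] at h2
  rw [smul_zero, map_mul, map_sub, aeval_X, aeval_C, mul_sub, sub_eq_zero] at h2
  rw [h2, Algebra.smul_def, Algebra.commutes]

theorem lo_ne_hi (j : Fin (n - 1)) : lo n j ≠ hi n j := by
  simp [lo, hi, Fin.ext_iff]

theorem pim_Bel_s3 [IsDomain R] (hr : 1 ≤ r) (hu : ∀ c d : Fin r, c ≠ d → IsUnit (u c - u d))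
    (hFdeg : ∀ c : Fin r, (F c).degree = ((r - 1 : ℕ) : WithBot ℕ))
    (hFeval : ∀ c c' : Fin r, (F c).eval (u c') = if c' = c then (Δ : R) else 0)
    (j : Fin (n - 1)) :
    pim R n r q Δ u F (Bel R n r q Δ u F j) =
      ∑ c2 : Fin r, ∑ c1 ∈ Finset.univ.filter (fun c1 => c1 < c2),
        ((u c2 - u c1) * ((q : R) - ((q⁻¹ : Rˣ) : R))) •
          (aeval (tt R n r q Δ u F (lo n j)) (bpoly R r u c1) *
            aeval (tt R n r q Δ u F (hi n j)) (bpoly R r u c2)) := by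
  have hF : ∀ (i : Fin n) (c : Fin r), pim R n r q Δ u F (aeval (tf R n i) (F c)) =
      (Δ : R) • aeval (tt R n r q Δ u F i) (bpoly R r u c) := by
    intro i c
    rw [← aeval_algHom_apply, eq_smul_bpoly hr hu (hFdeg c) (hFeval c), map_smul]
    rfl
  simp only [Bel, map_sum, map_smul, map_mul, hF, smul_mul_smul_comm, smul_smul]
  refine Finset.sum_congr rfl fun c2 _ => Finset.sum_congr rfl fun c1 _ => ?_
  congr 1
  have h : ((Δ⁻¹ : Rˣ) : R) * Δ = 1 := Δ.inv_mul
  linear_combination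
    (u c2 - u c1) * ((q : R) - ((q⁻¹ : Rˣ) : R)) * (((Δ⁻¹ : Rˣ) : R) * Δ + 1) * h

variable {φ : MvPolynomial (Fin n) R →ₐ[R] Hnr R n r q Δ u F}

theorem map_aeval_X (hφ : ∀ i, φ (MvPolynomial.X i) = tt R n r q Δ u F i) (i : Fin n) (p : R[X]) :
    φ (aeval (MvPolynomial.X i) p) = aeval (tt R n r q Δ u F i) p := by
  rw [← aeval_algHom_apply, hφ]

theorem map_prod_eq_tmon (hφ : ∀ i, φ (MvPolynomial.X i) = tt R n r q Δ u F i) (c : Fin n → ℕ) :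
    φ (∏ i, MvPolynomial.X i ^ c i) = tmon R n r q Δ u F c := by
  rw [← List.prod_ofFn, map_list_prod, List.map_ofFn, tmon]
  congr 2
  ext i
  simp [hφ]

theorem map_prod_eq_b (hφ : ∀ i, φ (MvPolynomial.X i) = tt R n r q Δ u F i) (k : Fin n → Fin r) :
    φ (∏ i, aeval (MvPolynomial.X i) (bpoly R r u (k i))) = b R n r q Δ u F k := by
  rw [← List.prod_ofFn, map_list_prod, List.map_ofFn, b]
  congr 2
  ext i
  exact map_aeval_X hφ i _

theorem B'_eq_map (hφ : ∀ i, φ (MvPolynomial.X i) = tt R n r q Δ u F i) (i j : Fin n) :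
    B' R n r q Δ u F i j = φ (-(((q : R) - ((q⁻¹ : Rˣ) : R)) •
      ∑ k ∈ Finset.univ.filter (fun k : Fin n → Fin r => k i < k j),
        ∏ l, aeval (MvPolynomial.X l) (bpoly R r u (k l)))) := by
  simp only [B', map_neg, map_smul, map_sum, map_prod_eq_b hφ]

theorem B'_eq_sum [IsDomain R] (hr : 1 ≤ r) (hu : ∀ c d : Fin r, c ≠ d → IsUnit (u c - u d))
    {i j : Fin n} (hij : i ≠ j) :
    B' R n r q Δ u F i j = -(((q : R) - ((q⁻¹ : Rˣ) : R)) •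
      ∑ c2 : Fin r, ∑ c1 ∈ Finset.univ.filter (fun c1 => c1 < c2),
        aeval (tt R n r q Δ u F i) (bpoly R r u c1) *
          aeval (tt R n r q Δ u F j) (bpoly R r u c2)) := by
  obtain ⟨φ, hφ⟩ := exists_mvPolynomial_algHom (R := R) (tt R n r q Δ u F) tt_comm
  rw [B'_eq_map hφ, sum_filter_prod_eq
    (fun i c => aeval (MvPolynomial.X i : MvPolynomial (Fin n) R) (bpoly R r u c)) _ hij]
  · simp only [map_neg, map_smul, map_sum, map_mul, map_aeval_X hφ]
  · intro l
    rw [← map_sum, sum_bpoly hr hu, map_one]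

theorem commute_B'_tt (i j l : Fin n) :
    B' R n r q Δ u F i j * tt R n r q Δ u F l = tt R n r q Δ u F l * B' R n r q Δ u F i j := by
  obtain ⟨φ, hφ⟩ := exists_mvPolynomial_algHom (R := R) (tt R n r q Δ u F) tt_comm
  rw [B'_eq_map hφ, ← hφ l, ← map_mul, ← map_mul, mul_comm]

theorem B'_mul_sub [IsDomain R] (hr : 1 ≤ r) (hu : ∀ c d : Fin r, c ≠ d → IsUnit (u c - u d))
    (hFdeg : ∀ c : Fin r, (F c).degree = ((r - 1 : ℕ) : WithBot ℕ))
    (hFeval : ∀ c c' : Fin r, (F c).eval (u c') = if c' = c then (Δ : R) else 0)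
    (j : Fin (n - 1)) :
    B' R n r q Δ u F (lo n j) (hi n j) *
        (tt R n r q Δ u F (lo n j) - tt R n r q Δ u F (hi n j)) =
      pim R n r q Δ u F (Bel R n r q Δ u F j) := by
  rw [pim_Bel_s3 hr hu hFdeg hFeval, B'_eq_sum hr hu (lo_ne_hi j)]
  refine neg_smul_sum_mul_sub _ u _ _ (aeval_bpoly_mul_tt _) (aeval_bpoly_mul_tt _) fun c => ?_
  obtain ⟨φ, hφ⟩ := exists_mvPolynomial_algHom (R := R) (tt R n r q Δ u F) tt_comm
  rw [← map_aeval_X hφ, ← hφ (lo n j), ← map_mul, ← map_mul, mul_comm]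

theorem g_mul_tt [IsDomain R] (hr : 1 ≤ r) (hu : ∀ c d : Fin r, c ≠ d → IsUnit (u c - u d))
    (hFdeg : ∀ c : Fin r, (F c).degree = ((r - 1 : ℕ) : WithBot ℕ))
    (hFeval : ∀ c c' : Fin r, (F c).eval (u c') = if c' = c then (Δ : R) else 0)
    (j : Fin (n - 1)) (i : Fin n) :
    g R n r q Δ u F j * tt R n r q Δ u F i =
      tt R n r q Δ u F (Equiv.swap (lo n j) (hi n j) i) * g R n r q Δ u F j := by
  have hB := B'_mul_sub (q := q) (n := n) hr hu hFdeg hFeval j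
  rw [mul_sub] at hB
  rcases eq_or_ne i (lo n j) with rfl | h1
  · have h := pim_eq (Rel.Tlo (q := q) (Δ := Δ) (u := u) (F := F) j)
    rw [map_mul, map_sub, map_mul, ← hB] at h
    change TT R n r q Δ u F j * tt R n r q Δ u F (lo n j) =
      tt R n r q Δ u F (hi n j) * TT R n r q Δ u F j - _ at h
    rw [Equiv.swap_apply_left, g, add_mul, h, mul_add, ← commute_B'_tt _ _ (hi n j)]
    abel
  rcases eq_or_ne i (hi n j) with rfl | h2
  · have h := pim_eq (Rel.Thi (q := q) (Δ := Δ) (u := u) (F := F) j)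
    rw [map_mul, map_add, map_mul, ← hB] at h
    change TT R n r q Δ u F j * tt R n r q Δ u F (hi n j) =
      tt R n r q Δ u F (lo n j) * TT R n r q Δ u F j + _ at h
    rw [Equiv.swap_apply_right, g, add_mul, h, mul_add, ← commute_B'_tt _ _ (lo n j)]
    abel
  · have h := pim_eq (Rel.Tt (q := q) (Δ := Δ) (u := u) (F := F) j i h1 h2)
    rw [map_mul, map_mul] at h
    change TT R n r q Δ u F j * tt R n r q Δ u F i =
      tt R n r q Δ u F i * TT R n r q Δ u F j at h
    rw [Equiv.swap_apply_of_ne_of_ne h1 h2, g, add_mul, mul_add, h, commute_B'_tt]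

/-- An element intertwining the `t_i` up to a permutation intertwines all polynomials in them. -/
theorem mul_map_eq_map_rename_mul (hφ : ∀ i, φ (MvPolynomial.X i) = tt R n r q Δ u F i)
    {x : Hnr R n r q Δ u F} {s : Fin n → Fin n}
    (hx : ∀ i, x * tt R n r q Δ u F i = tt R n r q Δ u F (s i) * x) (p : MvPolynomial (Fin n) R) :
    x * φ p = φ (MvPolynomial.rename s p) * x := by
  induction p using MvPolynomial.induction_on with
  | C a =>
    rw [MvPolynomial.rename_C, ← MvPolynomial.algebraMap_eq, AlgHom.commutes, Algebra.commutes]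
  | add p p' hp hp' => rw [map_add, mul_add, hp, hp', map_add, map_add, add_mul]
  | mul_X p i hp =>
    rw [map_mul, ← mul_assoc, hp, mul_assoc, hφ, hx, map_mul, map_mul, MvPolynomial.rename_X, hφ,
      mul_assoc]

end Relations

end MAK

/-- Proposition 3.3: `g_j t_i = t_{s_j(i)} g_j`, and consequently
`g_j · f(t_1,…,t_n) = f(t_{s_j(1)},…,t_{s_j(n)}) · g_j` for any polynomial `f`
(stated for monomials, which span all polynomials). -/
theorem statement3
    (R : Type*) [CommRing R] [IsDomain R] (n r : ℕ) (hn : 1 ≤ n) (hr : 1 ≤ r)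
    (q Δ : Rˣ) (u : Fin r → R) (F : Fin r → R[X])
    (hΔ : (Δ : R) = ∏ i : Fin r, ∏ j ∈ Finset.univ.filter (fun j => j < i), (u i - u j))
    (hFdeg : ∀ c : Fin r, (F c).degree = ((r - 1 : ℕ) : WithBot ℕ))
    (hFeval : ∀ c c' : Fin r, (F c).eval (u c') = if c' = c then (Δ : R) else 0) :
    (∀ (j : Fin (n - 1)) (i : Fin n),
        g R n r q Δ u F j * tt R n r q Δ u F i =
          tt R n r q Δ u F (Equiv.swap (lo n j) (hi n j) i) * g R n r q Δ u F j) ∧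
    (∀ (j : Fin (n - 1)) (c : Fin n → ℕ),
        g R n r q Δ u F j * tmon R n r q Δ u F c =
          tmon R n r q Δ u F (fun i => c (Equiv.swap (lo n j) (hi n j) i)) * g R n r q Δ u F j) := by
  have hu : ∀ c d : Fin r, c ≠ d → IsUnit (u c - u d) := fun c d => isUnit_sub_of_ne hΔ
  refine ⟨g_mul_tt hr hu hFdeg hFeval, fun j c => ?_⟩
  obtain ⟨φ, hφ⟩ := exists_mvPolynomial_algHom (R := R) (tt R n r q Δ u F) tt_comm
  rw [← map_prod_eq_tmon hφ, ← map_prod_eq_tmon hφ,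
    mul_map_eq_map_rename_mul hφ (g_mul_tt hr hu hFdeg hFeval j), map_prod]
  simp only [map_pow, MvPolynomial.rename_X]
  rw [← Equiv.prod_comp (Equiv.swap (lo n j) (hi n j))
    fun i => (MvPolynomial.X i : MvPolynomial (Fin n) R) ^ c (Equiv.swap (lo n j) (hi n j) i)]
  simp
end
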